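/- Let 1 ≤ s ≤ m-1 and k ≥ 0, and let Ker_k^s∂^+ denote the space of k-homogeneous Cl^s-valued polynomials P with ∂^+P = 0. Then the space P_k^s of all k-homogeneous Cl^s-valued polynomials decomposes as a direct sum P_k^s = Ker_k^s∂^+ ⊕ (x•)Ker_{k-1}^{s+1}∂^+, and the projection onto Ker_k^s∂^+ along the second summand is P^+ = -(s+k)^{-1} ∂^+(x•). -/

import Mathlib

noncomputable section
open scoped TensorProduct
open CliffordAlgebra MvPolynomial

/-- The quadratic form of signature (0,m): Q(x) = -|x|². -/
def Qf (m : ℕ) : QuadraticForm ℝ (Fin m → ℝ) :=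
  - QuadraticMap.weightedSumSquares ℝ (fun _ : Fin m => (1 : ℝ))

/-- The real Clifford algebra Cl(0,m). -/
abbrev Cl (m : ℕ) := CliffordAlgebra (Qf m)

/-- The generators e₁,…,e_m. -/
def e (m : ℕ) (i : Fin m) : Cl m := CliffordAlgebra.ι (Qf m) (Pi.single i 1)

/-- Left outer (wedge) multiplication by `c`:  v ↦ (1/2)(c v + α(v) c). -/
def wedgeL (m : ℕ) (c : Cl m) : Cl m →ₗ[ℝ] Cl m :=
  (1/2 : ℝ) • (LinearMap.mulLeft ℝ c +
    (LinearMap.mulRight ℝ c) ∘ₗ (involute (Q := Qf m)).toLinearMap)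

/-- Left inner (dot) multiplication by `c`:  v ↦ (1/2)(c v - α(v) c). -/
def dotL (m : ℕ) (c : Cl m) : Cl m →ₗ[ℝ] Cl m :=
  (1/2 : ℝ) • (LinearMap.mulLeft ℝ c -
    (LinearMap.mulRight ℝ c) ∘ₗ (involute (Q := Qf m)).toLinearMap)

/-- Scalar polynomials on ℝ^m. -/
abbrev Pm (m : ℕ) := MvPolynomial (Fin m) ℝ

/-- The space P* of Cl(0,m)-valued polynomials on ℝ^m. -/
abbrev MS (m : ℕ) := Pm m ⊗[ℝ] Cl m

/-- Build an operator on Cl-valued polynomials from operators on each factor. -/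
def op (m : ℕ) (f : Pm m →ₗ[ℝ] Pm m) (g : Cl m →ₗ[ℝ] Cl m) : Module.End ℝ (MS m) :=
  TensorProduct.map f g

/-- The operator (x∧) of outer multiplication by the vector variable. -/
def xWedge (m : ℕ) : Module.End ℝ (MS m) :=
  ∑ j : Fin m, op m (LinearMap.mulLeft ℝ (X j)) (wedgeL m (e m j))

/-- The operator (x•) of inner multiplication by the vector variable. -/
def xDot (m : ℕ) : Module.End ℝ (MS m) :=
  ∑ j : Fin m, op m (LinearMap.mulLeft ℝ (X j)) (dotL m (e m j))

/-- Left Clifford multiplication by the vector variable x. -/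
def Xmul (m : ℕ) : Module.End ℝ (MS m) :=
  ∑ j : Fin m, op m (LinearMap.mulLeft ℝ (X j)) (LinearMap.mulLeft ℝ (e m j))

/-- The Dirac operator ∂ = Σ e_j ∂_{x_j}. -/
def Dirac (m : ℕ) : Module.End ℝ (MS m) :=
  ∑ j : Fin m, op m (pderiv j).toLinearMap (LinearMap.mulLeft ℝ (e m j))

/-- The exterior part ∂⁺ of the Dirac operator. -/
def dplus (m : ℕ) : Module.End ℝ (MS m) :=
  ∑ j : Fin m, op m (pderiv j).toLinearMap (wedgeL m (e m j))

/-- The interior part ∂⁻ of the Dirac operator. -/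
def dminus (m : ℕ) : Module.End ℝ (MS m) :=
  ∑ j : Fin m, op m (pderiv j).toLinearMap (dotL m (e m j))

/-- The Euler operator E = Σ x_j ∂_{x_j}. -/
def Euler (m : ℕ) : Module.End ℝ (MS m) :=
  ∑ j : Fin m, op m (LinearMap.mulLeft ℝ (X j) ∘ₗ (pderiv j).toLinearMap) LinearMap.id

/-- The fermionic Euler operator ∂⁺⌋ = -Σ (e_j∧)(e_j•). -/
def fermPlus (m : ℕ) : Module.End ℝ (MS m) :=
  - ∑ j : Fin m, op m LinearMap.id (wedgeL m (e m j) ∘ₗ dotL m (e m j))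

/-- The fermionic Euler operator ∂⁻⌋ = -Σ (e_j•)(e_j∧). -/
def fermMinus (m : ℕ) : Module.End ℝ (MS m) :=
  - ∑ j : Fin m, op m LinearMap.id (dotL m (e m j) ∘ₗ wedgeL m (e m j))

/-- The Laplacian Δ = Σ ∂_{x_j}². -/
def Lap (m : ℕ) : Module.End ℝ (MS m) :=
  ∑ j : Fin m, op m ((pderiv j).toLinearMap ∘ₗ (pderiv j).toLinearMap) LinearMap.id

/-- Multiplication by the Clifford square x² = -(x₁²+⋯+x_m²) of the vector variable. -/
def Mx2 (m : ℕ) : Module.End ℝ (MS m) :=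
  op m (LinearMap.mulLeft ℝ (-(∑ j : Fin m, (X j : Pm m) ^ 2))) LinearMap.id

/-- The space Cl^s of s-vectors: the span of products of s distinct generators. -/
def clGrade (m s : ℕ) : Submodule ℝ (Cl m) :=
  Submodule.span ℝ
    {x | ∃ l : List (Fin m), l.length = s ∧ l.Nodup ∧ x = (l.map (e m)).prod}

/-- The space P_k^s of k-homogeneous s-vector valued polynomials. -/
def Pks (m k s : ℕ) : Submodule ℝ (MS m) :=
  LinearMap.range (TensorProduct.map
    (MvPolynomial.homogeneousSubmodule (Fin m) ℝ k).subtype (clGrade m s).subtype)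

/-- The space of s-vector valued polynomials (no homogeneity). -/
def PsVal (m s : ℕ) : Submodule ℝ (MS m) :=
  LinearMap.range (TensorProduct.map (LinearMap.id : Pm m →ₗ[ℝ] Pm m) (clGrade m s).subtype)

/-- Homogeneous solutions of the Hodge–de Rham system: ∂⁺P = 0 and ∂⁻P = 0. -/
def Hks (m k s : ℕ) : Submodule ℝ (MS m) :=
  Pks m k s ⊓ LinearMap.ker (dplus m) ⊓ LinearMap.ker (dminus m)

/-- Homogeneous s-vector valued monogenic polynomials: ∂P = 0. -/
def HksD (m k s : ℕ) : Submodule ℝ (MS m) :=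
  Pks m k s ⊓ LinearMap.ker (Dirac m)

/-- Ker_k^s ∂⁺. -/
def KerP (m k s : ℕ) : Submodule ℝ (MS m) :=
  Pks m k s ⊓ LinearMap.ker (dplus m)

/-- Ker_k^s ∂⁻. -/
def KerM (m k s : ℕ) : Submodule ℝ (MS m) :=
  Pks m k s ⊓ LinearMap.ker (dminus m)


/-! ### Clifford algebra relations -/

theorem aux_swap (m : ℕ) (i j : Fin m) :
    e m i * e m j + e m j * e m i = (if i = j then (-2 : ℝ) else 0) • (1 : Cl m) := by
  unfold e
  rw [CliffordAlgebra.ι_mul_ι_add_swap, Algebra.algebraMap_eq_smul_one]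
  congr 1
  simp only [QuadraticMap.polar, Qf, neg_apply,
    QuadraticMap.weightedSumSquares_apply, Pi.add_apply, one_smul]
  simp only [mul_add, add_mul, Finset.sum_add_distrib, Pi.single_apply]
  by_cases h : i = j
  · subst h; simp; norm_num
  · simp [h, Ne.symm h]

theorem aux_inv (m : ℕ) (i : Fin m) : involute (e m i) = - e m i := by
  simp [e]

theorem wedgeL_apply (m : ℕ) (c v : Cl m) :
    wedgeL m c v = (1/2 : ℝ) • (c * v + involute v * c) := by
  simp [wedgeL]

theorem dotL_apply (m : ℕ) (c v : Cl m) :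
    dotL m c v = (1/2 : ℝ) • (c * v - involute v * c) := by
  simp [dotL]

theorem aux_swapL (m : ℕ) (i j : Fin m) (v : Cl m) :
    e m i * (e m j * v) + e m j * (e m i * v) = (if i = j then (-2 : ℝ) else 0) • v := by
  have h := congrArg (fun t => t * v) (aux_swap m i j)
  simpa only [add_mul, mul_assoc, smul_mul_assoc, one_mul] using h

theorem aux_swapR (m : ℕ) (i j : Fin m) (v : Cl m) :
    v * (e m i * e m j) + v * (e m j * e m i) = (if i = j then (-2 : ℝ) else 0) • v := by
  have h := congrArg (fun t => v * t) (aux_swap m i j)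
  simpa only [mul_add, mul_smul_comm, mul_one] using h

theorem wedge_wedge (m : ℕ) (i j : Fin m) (v : Cl m) :
    wedgeL m (e m i) (wedgeL m (e m j) v) + wedgeL m (e m j) (wedgeL m (e m i) v) = 0 := by
  have h1 := aux_swapL m i j v
  have h2 := aux_swapR m i j v
  simp only [wedgeL_apply, map_smul, map_add, map_mul, aux_inv, involute_involute, mul_add, add_mul,
    mul_smul_comm, smul_mul_assoc, mul_neg, neg_mul, mul_assoc]
  linear_combination (norm := module) (1/4 : ℝ) • h1 - (1/4 : ℝ) • h2

theorem dot_wedge (m : ℕ) (i j : Fin m) (v : Cl m) :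
    dotL m (e m i) (wedgeL m (e m j) v) + wedgeL m (e m j) (dotL m (e m i) v)
      = (if i = j then (-1 : ℝ) else 0) • v := by
  have h1 := aux_swapL m i j v
  have h2 := aux_swapR m i j v
  simp only [wedgeL_apply, dotL_apply, map_smul, map_add, map_sub, map_mul, aux_inv,
    involute_involute, mul_add, add_mul, mul_sub, sub_mul,
    mul_smul_comm, smul_mul_assoc, mul_neg, neg_mul, mul_assoc]
  by_cases h : i = j
  · simp only [h, if_true] at *
    linear_combination (norm := module) (1/4 : ℝ) • h1 + (1/4 : ℝ) • h2
  · simp only [h, if_false] at *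
    linear_combination (norm := module) (1/4 : ℝ) • h1 + (1/4 : ℝ) • h2

/-- Products of generators, as a list. -/
def eL (m : ℕ) (l : List (Fin m)) : Cl m := (l.map (e m)).prod

theorem eL_cons (m : ℕ) (i : Fin m) (l : List (Fin m)) : eL m (i :: l) = e m i * eL m l := by
  simp [eL]

theorem eL_append (m : ℕ) (a b : List (Fin m)) : eL m (a ++ b) = eL m a * eL m b := by
  simp [eL]

theorem inv_eL (m : ℕ) (l : List (Fin m)) :
    involute (eL m l) = (-1 : ℝ) ^ l.length • eL m l := by
  induction l with
  | nil => simp [eL]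
  | cons i l ih =>
    rw [eL_cons, map_mul, ih, aux_inv, List.length_cons, pow_succ]
    simp

theorem e_eL_notMem (m : ℕ) (j : Fin m) (l : List (Fin m)) (h : j ∉ l) :
    e m j * eL m l = (-1 : ℝ) ^ l.length • (eL m l * e m j) := by
  induction l with
  | nil => simp [eL]
  | cons i l ih =>
    simp only [List.mem_cons, not_or] at h
    have h1 := aux_swapL m j i (eL m l)
    rw [if_neg h.1, zero_smul] at h1
    rw [eL_cons, eq_neg_of_add_eq_zero_left h1, ih h.2, List.length_cons, pow_succ]
    simp [mul_assoc]

theorem e_sq (m : ℕ) (j : Fin m) : e m j * e m j = -1 := by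
  have h := aux_swap m j j
  rw [if_pos rfl] at h
  linear_combination (norm := module) (1/2 : ℝ) • h

theorem dotL_notMem (m : ℕ) (j : Fin m) (l : List (Fin m)) (h : j ∉ l) :
    dotL m (e m j) (eL m l) = 0 := by
  rw [dotL_apply, inv_eL, e_eL_notMem m j l h, smul_mul_assoc, sub_self, smul_zero]

theorem wedgeL_notMem (m : ℕ) (j : Fin m) (l : List (Fin m)) (h : j ∉ l) :
    wedgeL m (e m j) (eL m l) = eL m (j :: l) := by
  rw [wedgeL_apply, inv_eL, smul_mul_assoc, ← e_eL_notMem m j l h, eL_cons]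
  module

/-- A list with `j` in it: `e_l` is `±` the list with `j` in front. -/
theorem eL_mid (m : ℕ) (j : Fin m) (a b : List (Fin m)) (h : j ∉ a) :
    eL m (a ++ j :: b) = (-1 : ℝ) ^ a.length • eL m (j :: (a ++ b)) := by
  rw [eL_cons, eL_append, eL_append, eL_cons, ← mul_assoc, ← mul_assoc, e_eL_notMem m j a h,
    smul_mul_assoc, smul_smul, ← pow_add, Even.neg_one_pow ⟨_, rfl⟩, one_smul]

theorem wedgeL_cons_self (m : ℕ) (j : Fin m) (l : List (Fin m)) (h : j ∉ l) :
    wedgeL m (e m j) (eL m (j :: l)) = 0 := by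
  have h1 := wedge_wedge m j j (eL m l)
  rw [wedgeL_notMem m j l h] at h1
  linear_combination (norm := module) (1/2 : ℝ) • h1

theorem dotL_cons_self (m : ℕ) (j : Fin m) (l : List (Fin m)) (h : j ∉ l) :
    dotL m (e m j) (eL m (j :: l)) = - eL m l := by
  have h1 := dot_wedge m j j (eL m l)
  rw [wedgeL_notMem m j l h, dotL_notMem m j l h, if_pos rfl] at h1
  simpa using h1

theorem nodup_mid {m : ℕ} {l : List (Fin m)} (hl : l.Nodup) {j : Fin m} (h : j ∈ l) :
    ∃ (c : ℝ) (t : List (Fin m)), t.length + 1 = l.length ∧ t.Nodup ∧ j ∉ t ∧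
      eL m l = c • eL m (j :: t) := by
  obtain ⟨a, b, rfl⟩ := List.append_of_mem h
  rw [List.nodup_middle, List.nodup_cons] at hl
  refine ⟨(-1) ^ a.length, a ++ b, by simp; omega, hl.2, hl.1, eL_mid m j a b ?_⟩
  intro h'
  exact hl.1 (List.mem_append_left _ h')

theorem eL_mem (m : ℕ) (l : List (Fin m)) (hl : l.Nodup) : eL m l ∈ clGrade m l.length :=
  Submodule.subset_span ⟨l, rfl, hl, rfl⟩

theorem clGrade_ind {m s : ℕ} {p : Cl m → Prop} (h0 : p 0) (hadd : ∀ a b, p a → p b → p (a + b))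
    (hsmul : ∀ (c : ℝ) a, p a → p (c • a))
    (hl : ∀ l : List (Fin m), l.length = s → l.Nodup → p (eL m l)) {v : Cl m}
    (hv : v ∈ clGrade m s) : p v := by
  refine Submodule.span_induction (p := fun v _ => p v) ?_ h0 (fun a b _ _ => hadd a b)
    (fun c a _ => hsmul c a) hv
  rintro _ ⟨l, h1, h2, rfl⟩
  exact hl l h1 h2

theorem wedgeL_grade (m s : ℕ) (j : Fin m) {v : Cl m} (hv : v ∈ clGrade m s) :
    wedgeL m (e m j) v ∈ clGrade m (s + 1) := by
  refine clGrade_ind (p := fun v => wedgeL m (e m j) v ∈ clGrade m (s + 1)) ?_ ?_ ?_ ?_ hv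
  · simp
  · intro a b ha hb
    rw [map_add]; exact add_mem ha hb
  · intro c a ha
    rw [map_smul]; exact Submodule.smul_mem _ _ ha
  · intro l h1 h2
    by_cases h : j ∈ l
    · obtain ⟨c, t, ht1, ht2, ht3, ht4⟩ := nodup_mid h2 h
      rw [ht4, map_smul, wedgeL_cons_self m j t ht3, smul_zero]
      exact zero_mem _
    · rw [wedgeL_notMem m j l h, ← h1]
      exact eL_mem m (j :: l) (List.nodup_cons.2 ⟨h, h2⟩)

theorem dotL_grade (m s : ℕ) (j : Fin m) {v : Cl m} (hv : v ∈ clGrade m (s + 1)) :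
    dotL m (e m j) v ∈ clGrade m s := by
  refine clGrade_ind (p := fun v => dotL m (e m j) v ∈ clGrade m s) ?_ ?_ ?_ ?_ hv
  · simp
  · intro a b ha hb
    rw [map_add]; exact add_mem ha hb
  · intro c a ha
    rw [map_smul]; exact Submodule.smul_mem _ _ ha
  · intro l h1 h2
    by_cases h : j ∈ l
    · obtain ⟨c, t, ht1, ht2, ht3, ht4⟩ := nodup_mid h2 h
      rw [ht4, map_smul, dotL_cons_self m j t ht3]
      have : t.length = s := by omega
      rw [← this]
      exact Submodule.smul_mem _ _ (neg_mem (eL_mem m t ht2))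
    · rw [dotL_notMem m j l h]
      exact zero_mem _

theorem ferm_grade (m s : ℕ) {v : Cl m} (hv : v ∈ clGrade m s) :
    ∑ j : Fin m, wedgeL m (e m j) (dotL m (e m j) v) = (-(s : ℝ)) • v := by
  refine clGrade_ind (p := fun v => ∑ j : Fin m, wedgeL m (e m j) (dotL m (e m j) v)
    = (-(s : ℝ)) • v) ?_ ?_ ?_ ?_ hv
  · simp
  · intro a b ha hb
    simp only [map_add, Finset.sum_add_distrib, ha, hb, smul_add]
  · intro c a ha
    simp only [map_smul, ← Finset.smul_sum, ha]
    rw [smul_comm]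
  · intro l h1 h2
    have key : ∀ j : Fin m, wedgeL m (e m j) (dotL m (e m j) (eL m l))
        = if j ∈ l.toFinset then - eL m l else 0 := by
      intro j
      by_cases h : j ∈ l
      · obtain ⟨c, t, ht1, ht2, ht3, ht4⟩ := nodup_mid h2 h
        rw [if_pos (List.mem_toFinset.2 h), ht4, map_smul, dotL_cons_self m j t ht3, map_smul,
          map_neg, wedgeL_notMem m j t ht3, smul_neg]
      · rw [if_neg (by simpa using h), dotL_notMem m j l h, map_zero]
    rw [Finset.sum_congr rfl (fun j _ => key j), Finset.sum_ite_mem, Finset.univ_inter,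
      Finset.sum_const, List.toFinset_card_of_nodup h2, h1, ← Nat.cast_smul_eq_nsmul ℝ]
    module

/-! ### Operators on Clifford-valued polynomials -/

theorem dplus_tmul (m : ℕ) (p : Pm m) (v : Cl m) :
    dplus m (p ⊗ₜ[ℝ] v) = ∑ j : Fin m, (pderiv j p) ⊗ₜ[ℝ] (wedgeL m (e m j) v) := by
  simp [dplus, op, LinearMap.sum_apply]

theorem xDot_tmul (m : ℕ) (p : Pm m) (v : Cl m) :
    xDot m (p ⊗ₜ[ℝ] v) = ∑ j : Fin m, (X j * p) ⊗ₜ[ℝ] (dotL m (e m j) v) := by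
  simp [xDot, op, LinearMap.sum_apply]

theorem pderiv_comm' (m : ℕ) (i j : Fin m) (p : Pm m) :
    pderiv i (pderiv j p) = pderiv j (pderiv i p) := by
  have h : ⁅pderiv (R := ℝ) i, pderiv (R := ℝ) j⁆ = (0 : Derivation ℝ (Pm m) (Pm m)) := by
    apply MvPolynomial.derivation_ext
    intro k
    simp [Derivation.commutator_apply, pderiv_X, Pi.single_apply, apply_ite]
  have h2 := congrArg (fun D => D p) h
  simp only [Derivation.commutator_apply] at h2
  exact sub_eq_zero.1 h2

theorem dplus_dplus (m : ℕ) (P : MS m) : dplus m (dplus m P) = 0 := by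
  induction P using TensorProduct.induction_on with
  | zero => simp
  | add a b ha hb => rw [map_add, map_add, ha, hb, add_zero]
  | tmul p v =>
    rw [dplus_tmul, map_sum]
    simp only [dplus_tmul]
    set S := ∑ j : Fin m, ∑ i : Fin m,
      (pderiv i (pderiv j p)) ⊗ₜ[ℝ] (wedgeL m (e m i) (wedgeL m (e m j) v)) with hS
    have h : S + S = 0 := by
      nth_rewrite 2 [hS]
      rw [Finset.sum_comm, hS, ← Finset.sum_add_distrib]
      refine Finset.sum_eq_zero fun j _ => ?_
      rw [← Finset.sum_add_distrib]
      refine Finset.sum_eq_zero fun i _ => ?_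
      rw [pderiv_comm' m j i, ← TensorProduct.tmul_add, wedge_wedge, TensorProduct.tmul_zero]
    linear_combination (norm := module) (1/2 : ℝ) • h

theorem Pks_ind {m k s : ℕ} {p : MS m → Prop} (h0 : p 0) (hadd : ∀ a b, p a → p b → p (a + b))
    (ht : ∀ (q : Pm m) (v : Cl m), q.IsHomogeneous k → v ∈ clGrade m s → p (q ⊗ₜ[ℝ] v))
    {P : MS m} (hP : P ∈ Pks m k s) : p P := by
  obtain ⟨T, rfl⟩ := hP
  induction T using TensorProduct.induction_on with
  | zero => simpa using h0
  | add a b ha hb => rw [map_add]; exact hadd _ _ ha hb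
  | tmul q v =>
    rw [TensorProduct.map_tmul]
    exact ht _ _ ((mem_homogeneousSubmodule _ _).1 q.2) v.2

theorem tmul_mem_Pks {m k s : ℕ} {q : Pm m} {v : Cl m} (hq : q.IsHomogeneous k)
    (hv : v ∈ clGrade m s) : q ⊗ₜ[ℝ] v ∈ Pks m k s :=
  ⟨(⟨q, (mem_homogeneousSubmodule _ _).2 hq⟩ : homogeneousSubmodule (Fin m) ℝ k) ⊗ₜ[ℝ]
    (⟨v, hv⟩ : clGrade m s), by rw [TensorProduct.map_tmul]; rfl⟩

theorem dplus_mem {m k s : ℕ} {P : MS m} (hP : P ∈ Pks m k s) :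
    dplus m P ∈ Pks m (k - 1) (s + 1) := by
  refine Pks_ind (p := fun P => dplus m P ∈ Pks m (k - 1) (s + 1)) ?_ ?_ ?_ hP
  · simp
  · intro a b ha hb
    rw [map_add]; exact add_mem ha hb
  · intro q v hq hv
    rw [dplus_tmul]
    exact sum_mem fun j _ => tmul_mem_Pks hq.pderiv (wedgeL_grade m s j hv)

theorem xDot_mem {m k s : ℕ} {P : MS m} (hP : P ∈ Pks m k (s + 1)) :
    xDot m P ∈ Pks m (k + 1) s := by
  refine Pks_ind (p := fun P => xDot m P ∈ Pks m (k + 1) s) ?_ ?_ ?_ hP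
  · simp
  · intro a b ha hb
    rw [map_add]; exact add_mem ha hb
  · intro q v hq hv
    rw [xDot_tmul]
    refine sum_mem fun j _ => tmul_mem_Pks ?_ (dotL_grade m s j hv)
    rw [add_comm]
    exact (isHomogeneous_X ℝ j).mul hq

theorem key_identity {m k s : ℕ} {P : MS m} (hP : P ∈ Pks m k s) :
    xDot m (dplus m P) + dplus m (xDot m P) = (-((s : ℝ) + (k : ℝ))) • P := by
  refine Pks_ind (p := fun P => xDot m (dplus m P) + dplus m (xDot m P)
    = (-((s : ℝ) + (k : ℝ))) • P) ?_ ?_ ?_ hP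
  · simp
  · intro a b ha hb
    simp only [map_add, smul_add, ← ha, ← hb]
    abel
  · intro q v hq hv
    have hE := hq.sum_X_mul_pderiv
    have hF := ferm_grade m s hv
    rw [dplus_tmul, xDot_tmul, map_sum, map_sum]
    simp only [xDot_tmul, dplus_tmul]
    rw [Finset.sum_comm, ← Finset.sum_add_distrib]
    have hterm : ∀ i : Fin m,
        (∑ j : Fin m, (X i * pderiv j q) ⊗ₜ[ℝ] (dotL m (e m i) (wedgeL m (e m j) v)) +
          ∑ j : Fin m, (pderiv j (X i * q)) ⊗ₜ[ℝ] (wedgeL m (e m j) (dotL m (e m i) v)))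
        = (-1 : ℝ) • ((X i * pderiv i q) ⊗ₜ[ℝ] v)
          + q ⊗ₜ[ℝ] (wedgeL m (e m i) (dotL m (e m i) v)) := by
      intro i
      rw [← Finset.sum_add_distrib]
      have h1 : ∀ j : Fin m,
          (X i * pderiv j q) ⊗ₜ[ℝ] (dotL m (e m i) (wedgeL m (e m j) v)) +
          (pderiv j (X i * q)) ⊗ₜ[ℝ] (wedgeL m (e m j) (dotL m (e m i) v))
          = if i = j then ((-1 : ℝ) • ((X i * pderiv i q) ⊗ₜ[ℝ] v)
          + q ⊗ₜ[ℝ] (wedgeL m (e m i) (dotL m (e m i) v))) else 0 := by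
        intro j
        rw [Derivation.leibniz, smul_eq_mul, smul_eq_mul, TensorProduct.add_tmul, ← add_assoc,
          ← TensorProduct.tmul_add, dot_wedge]
        by_cases h : i = j
        · subst h
          rw [if_pos rfl, if_pos rfl, pderiv_X_self, mul_one, TensorProduct.tmul_smul]
        · simp [h, pderiv_X]
      rw [Finset.sum_congr rfl (fun j _ => h1 j), Finset.sum_ite_eq, if_pos (Finset.mem_univ _)]
    rw [Finset.sum_congr rfl (fun i _ => hterm i), Finset.sum_add_distrib, ← Finset.smul_sum,
      ← TensorProduct.sum_tmul, ← TensorProduct.tmul_sum, hE, hF, TensorProduct.tmul_smul,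
      ← Nat.cast_smul_eq_nsmul ℝ, ← TensorProduct.smul_tmul']
    module

theorem proj_mem {m k s : ℕ} (hs1 : 1 ≤ s) {P : MS m} (hP : P ∈ Pks m k s) (c : ℝ) :
    c • dplus m (xDot m P) ∈ KerP m k s := by
  have hA : dplus m (xDot m P) ∈ Pks m k s := by
    obtain ⟨t, rfl⟩ : ∃ t, s = t + 1 := ⟨s - 1, by omega⟩
    have h1 : xDot m P ∈ Pks m (k + 1) t := xDot_mem hP
    have h2 := dplus_mem h1
    rw [Nat.add_sub_cancel] at h2
    exact h2
  refine Submodule.mem_inf.2 ⟨Submodule.smul_mem _ _ hA, ?_⟩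
  rw [LinearMap.mem_ker, map_smul, dplus_dplus, smul_zero]

theorem dplus_mem_KerP {m k s : ℕ} {P : MS m} (hP : P ∈ Pks m k s) (c : ℝ) :
    c • dplus m P ∈ KerP m (k - 1) (s + 1) := by
  refine Submodule.mem_inf.2 ⟨Submodule.smul_mem _ _ (dplus_mem hP), ?_⟩
  rw [LinearMap.mem_ker, map_smul, dplus_dplus, smul_zero]

theorem proj_identity {m k s : ℕ} (hne : (s : ℝ) + (k : ℝ) ≠ 0) {P : MS m}
    (hP : P ∈ Pks m k s) :
    xDot m ((-(((s : ℝ) + (k : ℝ))⁻¹)) • dplus m P)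
      = P - (-(((s : ℝ) + (k : ℝ))⁻¹)) • dplus m (xDot m P) := by
  have h := key_identity hP
  have h1 : ((s : ℝ) + (k : ℝ))⁻¹ * ((s : ℝ) + (k : ℝ)) = 1 := inv_mul_cancel₀ hne
  have h2 : (-(((s : ℝ) + (k : ℝ))⁻¹)) • xDot m (dplus m P)
      + (-(((s : ℝ) + (k : ℝ))⁻¹)) • dplus m (xDot m P) = P := by
    rw [← smul_add, h, smul_smul, neg_mul_neg, h1, one_smul]
  rw [map_smul]
  exact eq_sub_of_add_eq h2

theorem inter_zero {m k s : ℕ} {R : MS m} (hR : R ∈ KerP m k (s + 1))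
    (h0 : dplus m (xDot m R) = 0) : R = 0 := by
  obtain ⟨hR, hRker⟩ := Submodule.mem_inf.1 hR
  have h := key_identity hR
  rw [LinearMap.mem_ker] at hRker
  rw [h0, hRker, map_zero, add_zero] at h
  have hne2 : (-(((s + 1 : ℕ) : ℝ) + (k : ℝ))) ≠ 0 := by
    rw [neg_ne_zero]; positivity
  exact (smul_eq_zero.1 h.symm).resolve_left hne2


end
/-- P_k^s = Ker_k^s∂⁺ ⊕ (x•)Ker_{k-1}^{s+1}∂⁺, with projection
P⁺ = -(s+k)⁻¹ ∂⁺(x•) onto the first summand (here the second summand is intersected with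
P_k^s, which encodes the convention that polynomials of negative degree vanish). -/
theorem stmt12 (m k s : ℕ) (hs1 : 1 ≤ s) (hs2 : s ≤ m - 1) :
    Pks m k s = KerP m k s ⊔ (Submodule.map (xDot m) (KerP m (k - 1) (s + 1)) ⊓ Pks m k s) ∧
    KerP m k s ⊓ (Submodule.map (xDot m) (KerP m (k - 1) (s + 1)) ⊓ Pks m k s) = ⊥ ∧
    ∀ P ∈ Pks m k s,
      (-(((s : ℝ) + (k : ℝ))⁻¹) • (dplus m * xDot m)) P ∈ KerP m k s ∧
      P - (-(((s : ℝ) + (k : ℝ))⁻¹) • (dplus m * xDot m)) P ∈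
        Submodule.map (xDot m) (KerP m (k - 1) (s + 1)) ⊓ Pks m k s := by
  have hne : (s : ℝ) + (k : ℝ) ≠ 0 := by
    have : (1 : ℝ) ≤ s := by exact_mod_cast hs1
    positivity
  have hproj : ∀ P ∈ Pks m k s,
      (-(((s : ℝ) + (k : ℝ))⁻¹) • (dplus m * xDot m)) P ∈ KerP m k s ∧
      P - (-(((s : ℝ) + (k : ℝ))⁻¹) • (dplus m * xDot m)) P ∈
        Submodule.map (xDot m) (KerP m (k - 1) (s + 1)) ⊓ Pks m k s := by
    intro P hP
    rw [LinearMap.smul_apply, Module.End.mul_apply]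
    have hA := proj_mem hs1 hP (-(((s : ℝ) + (k : ℝ))⁻¹))
    refine ⟨hA, Submodule.mem_inf.2 ⟨Submodule.mem_map.2 ⟨_, dplus_mem_KerP hP _,
      proj_identity hne hP⟩, Submodule.sub_mem _ hP (Submodule.mem_inf.1 hA).1⟩⟩
  refine ⟨le_antisymm ?_ ?_, ?_, hproj⟩
  · intro P hP
    have h := hproj P hP
    exact Submodule.mem_sup.2 ⟨_, h.1, _, h.2, add_sub_cancel _ _⟩
  · exact sup_le inf_le_left inf_le_right
  · rw [Submodule.eq_bot_iff]
    intro x hx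
    obtain ⟨hx1, hx2⟩ := Submodule.mem_inf.1 hx
    obtain ⟨R, hR, rfl⟩ := Submodule.mem_map.1 (Submodule.mem_inf.1 hx2).1
    rw [inter_zero hR (LinearMap.mem_ker.1 (Submodule.mem_inf.1 hx1).2), map_zero]
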